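/- Let E and F be real normed vector spaces, h : E → F a K-Lipschitz map with K > 0, ε > 0, and a, b ∈ ℝ. Let P be a probability measure on E × E and τ ∈ (0,1) such that P{(u,v) : ‖h(u) − h(v)‖ ≥ a} ≥ 1 − τ. Then P{(u,v) : for every x ∈ E with ‖x − u‖ ≤ ε, either ‖h(x) − h(v)‖ > b or ε ≥ (a − b)/K} ≥ 1 − τ. -/

import Mathlib

open MeasureTheory

/-- Probabilistic statement of SPADE Theorem 1: if with probability at least `1 − τ`
the latent distance `‖h u − h v‖` is at least `a`, then with probability at least
`1 − τ`, for every adversarial sample `x` within distance `ε` of `u`, either the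
classifier abstains (`‖h x − h v‖ > b`) or `ε ≥ (a − b)/K`. -/
theorem spade_probabilistic_theorem
    {E F : Type*} [NormedAddCommGroup E] [NormedSpace ℝ E]
    [MeasurableSpace E] [BorelSpace E]
    [NormedAddCommGroup F] [NormedSpace ℝ F]
    (h : E → F) (K : ℝ) (hK : 0 < K)
    (hLip : LipschitzWith (Real.toNNReal K) h)
    (ε a b : ℝ) (hε : 0 < ε)
    (P : Measure (E × E)) [IsProbabilityMeasure P]
    (τ : ℝ) (hτ : τ ∈ Set.Ioo (0 : ℝ) 1)
    (hquant : ENNReal.ofReal (1 - τ) ≤ P {p : E × E | a ≤ ‖h p.1 - h p.2‖}) :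
    ENNReal.ofReal (1 - τ) ≤
      P {p : E × E | ∀ x : E, ‖x - p.1‖ ≤ ε →
          b < ‖h x - h p.2‖ ∨ (a - b) / K ≤ ε} := by
  refine hquant.trans (measure_mono fun p hp x hx => ?_)
  have hp : a ≤ ‖h p.1 - h p.2‖ := hp
  rw [or_iff_not_imp_right, not_le, lt_div_iff₀ hK]
  intro hlt
  have hLipx : ‖h x - h p.1‖ ≤ K * ‖x - p.1‖ := by
    simpa [Real.coe_toNNReal K hK.le] using hLip.norm_sub_le x p.1
  have htri : ‖h p.1 - h p.2‖ ≤ ‖h x - h p.1‖ + ‖h x - h p.2‖ := by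
    simpa only [norm_sub_rev (h p.1) (h x)] using
      norm_sub_le_norm_sub_add_norm_sub (h p.1) (h x) (h p.2)
  have hKε : K * ‖x - p.1‖ ≤ K * ε := by gcongr
  linarith
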